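/- arXiv:1409.7647 — 2 statements merged into one kernel-verified Lean document; each statement's English description precedes it below -/
import Mathlib

section
/- Let h̃₁(b, b_x) = −b⁴b⁵b_x¹ − b⁵b²b_x² + b²b⁴b_x³ − b²b⁶. Then for every smooth curve b: ℝ → ℝ⁶ with b'¹(x) ≠ 0 for all x, and for all i ∈ {1, …, 6} and all x, −Σ_{β,γ,s} φ^{βγ} ψ^i_β(b'(x)) · (d/dx)[ψ^s_γ(b'(x)) E_s(h̃₁)(x)] = v^i(b'(x)). That is, the first six-component WDVV hydrodynamic type system a_y = (v(a))_x, written in potential form b_y^i = v^i(b_x) with a = b_x, is Hamiltonian with nonlocal Hamiltonian density h̃₁ with respect to the factorised third-order Hamiltonian operator determined by Ψ and Φ. -/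
open scoped BigOperators

/-- Euler–Lagrange (variational) derivative of a density `h(b, b_x)` along a curve `b`. -/
noncomputable def ELd (h : (Fin 6 → ℝ) → (Fin 6 → ℝ) → ℝ)
    (b : ℝ → Fin 6 → ℝ) (s : Fin 6) (x : ℝ) : ℝ :=
  fderiv ℝ (fun u => h u (deriv b x)) (b x) (Pi.single s 1)
  - deriv (fun y => fderiv ℝ (fun v => h (b y) v) (deriv b y) (Pi.single s 1)) x

/-- The matrix Ψ(a) = (ψ^γ_i(a)) (row index i, column index γ). -/
noncomputable def ΨW (a : Fin 6 → ℝ) : Matrix (Fin 6) (Fin 6) ℝ :=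
  !![1, a 4, a 3, 0, 0, 0;
     0, a 2, 0, 1, a 4, 0;
     0, -a 1, 0, 0, -a 3, 1;
     0, 0, -a 0, 0, a 2, 0;
     0, -a 0, 0, 0, -a 1, 0;
     0, 0, 0, 0, -1, 0]

/-- The constant symmetric matrix Φ = (φ_{βγ}). -/
noncomputable def ΦW : Matrix (Fin 6) (Fin 6) ℝ :=
  !![0, 0, 0, 0, -1, 0;
     0, 0, 0, -1, 0, 0;
     0, 0, 1, 0, 0, 1;
     0, -1, 0, 0, 0, 0;
     -1, 0, 0, 0, 0, 0;
     0, 0, 1, 0, 0, 2]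

/-- The velocity v(a) of the first six-component WDVV hydrodynamic type system. -/
noncomputable def vW (a : Fin 6 → ℝ) : Fin 6 → ℝ :=
  ![a 1, a 3, a 4, (2*a 4 + a 1*a 3)/a 0, (a 2*a 3 + a 5)/a 0,
    (2*a 2*a 4 - a 1*a 5)/a 0]

/-- The nonlocal Hamiltonian density h̃₁ of the first WDVV hydrodynamic type system. -/
noncomputable def h1W (b bx : Fin 6 → ℝ) : ℝ :=
  -(b 3)*(b 4)*(bx 0) - (b 4)*(b 1)*(bx 1) + (b 1)*(b 3)*(bx 2) - (b 1)*(b 5)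

theorem hasDerivAt_coord {b : ℝ → Fin 6 → ℝ} (hb : ContDiff ℝ (⊤ : ℕ∞) b) (i : Fin 6) (x : ℝ) :
    HasDerivAt (fun y => b y i) (deriv b x i) x :=
  hasDerivAt_pi.1 ((hb.differentiable (by simp)) x).hasDerivAt i

theorem differentiable_deriv_coord {b : ℝ → Fin 6 → ℝ} (hb : ContDiff ℝ (⊤ : ℕ∞) b) (i : Fin 6) :
    Differentiable ℝ (fun y => deriv b y i) := by
  have h : ContDiff ℝ (⊤ : ℕ∞) (deriv b) := (contDiff_infty_iff_deriv.1 hb).2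
  exact fun x => differentiableAt_pi.1 (h.differentiable (by simp) x) i

theorem fderiv_h1W_left (u v w : Fin 6 → ℝ) :
    fderiv ℝ (fun u => h1W u v) u w =
      -(w 3 * u 4 + u 3 * w 4) * v 0 - (w 4 * u 1 + u 4 * w 1) * v 1
        + (w 1 * u 3 + u 1 * w 3) * v 2 - (w 1 * u 5 + u 1 * w 5) := by
  have p (i : Fin 6) := hasFDerivAt_apply (𝕜 := ℝ) (F' := fun _ : Fin 6 => ℝ) i u
  have h := (((((p 3).neg.mul (p 4)).mul_const (v 0)).sub
    (((p 4).mul (p 1)).mul_const (v 1))).add (((p 1).mul (p 3)).mul_const (v 2))).sub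
    ((p 1).mul (p 5))
  have e : fderiv ℝ (fun u => h1W u v) u = _ := h.fderiv
  rw [e]
  simp
  ring

theorem fderiv_h1W_right (u v w : Fin 6 → ℝ) :
    fderiv ℝ (fun v => h1W u v) v w =
      -(u 3 * u 4) * w 0 - u 4 * u 1 * w 1 + u 1 * u 3 * w 2 := by
  have p (i : Fin 6) := hasFDerivAt_apply (𝕜 := ℝ) (F' := fun _ : Fin 6 => ℝ) i v
  have h := ((((p 0).const_mul (-(u 3) * u 4)).sub ((p 1).const_mul (u 4 * u 1))).add
    ((p 2).const_mul (u 1 * u 3))).sub_const (u 1 * u 5)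
  have e : fderiv ℝ (fun v => h1W u v) v = _ := h.fderiv
  rw [e]
  simp

/-- The variational derivative of `h1W` as a function of the values of `b` and `b_x`. -/
def h1WEL (b a : Fin 6 → ℝ) : Fin 6 → ℝ :=
  ![a 3 * b 4 + b 3 * a 4, b 3 * a 2 - b 5 + a 4 * b 1, -(a 1 * b 3) - b 1 * a 3,
    -(b 4 * a 0) + b 1 * a 2, -(b 3 * a 0) - b 1 * a 1, -b 1]

theorem ELd_h1W {b : ℝ → Fin 6 → ℝ} (hb : ContDiff ℝ (⊤ : ℕ∞) b) (s : Fin 6) (x : ℝ) :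
    ELd h1W b s x = h1WEL (b x) (deriv b x) s := by
  have p (i : Fin 6) := hasDerivAt_coord hb i x
  simp only [ELd, fderiv_h1W_left, fderiv_h1W_right]
  have h := (((((p 3).mul (p 4)).neg).mul_const ((Pi.single s 1 : Fin 6 → ℝ) 0)).sub
    (((p 4).mul (p 1)).mul_const ((Pi.single s 1 : Fin 6 → ℝ) 1))).add
    (((p 1).mul (p 3)).mul_const ((Pi.single s 1 : Fin 6 → ℝ) 2))
  have e : deriv (fun y => -(b y 3 * b y 4) * (Pi.single s 1 : Fin 6 → ℝ) 0
      - b y 4 * b y 1 * (Pi.single s 1 : Fin 6 → ℝ) 1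
      + b y 1 * b y 3 * (Pi.single s 1 : Fin 6 → ℝ) 2) x = _ := h.deriv
  rw [e]
  fin_cases s <;> simp [h1WEL] <;> ring

/-- The inverse of `ΨW a` for `a 0 ≠ 0`. -/
noncomputable def ΨWInv (a : Fin 6 → ℝ) : Matrix (Fin 6) (Fin 6) ℝ :=
  !![1, 0, 0, a 3 / a 0, a 4 / a 0, (a 3 * a 2 - a 4 * a 1) / a 0;
     0, 0, 0, 0, -1 / a 0, a 1 / a 0;
     0, 0, 0, -1 / a 0, 0, -a 2 / a 0;
     0, 1, 0, 0, a 2 / a 0, a 4 - a 2 * a 1 / a 0;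
     0, 0, 0, 0, 0, -1;
     0, 0, 1, 0, -a 1 / a 0, a 1 * a 1 / a 0 - a 3]

theorem inv_ΨW {a : Fin 6 → ℝ} (ha : a 0 ≠ 0) : (ΨW a)⁻¹ = ΨWInv a := by
  refine Matrix.inv_eq_right_inv ?_
  ext i j
  fin_cases i <;> fin_cases j <;>
    simp [ΨW, ΨWInv, Matrix.mul_apply, Fin.sum_univ_six] <;> field_simp <;> ring

set_option maxHeartbeats 1000000 in
theorem differentiable_ΨWInv {a : ℝ → Fin 6 → ℝ} (hd : ∀ i, Differentiable ℝ (fun y => a y i))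
    (ha : ∀ x, a x 0 ≠ 0) (γ s : Fin 6) : Differentiable ℝ (fun y => ΨWInv (a y) γ s) := by
  fin_cases γ <;> fin_cases s <;> simp [ΨWInv] <;> fun_prop (disch := exact ha _)

theorem inv_ΦW : ΦW⁻¹ =
    !![0, 0, 0, 0, -1, 0;
       0, 0, 0, -1, 0, 0;
       0, 0, 2, 0, 0, -1;
       0, -1, 0, 0, 0, 0;
       -1, 0, 0, 0, 0, 0;
       0, 0, -1, 0, 0, 1] := by
  refine Matrix.inv_eq_right_inv ?_
  ext i j
  fin_cases i <;> fin_cases j <;>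
    simp [ΦW, Matrix.mul_apply, Fin.sum_univ_six] <;> norm_num

theorem sum_ΨWInv_mul_h1WEL {b a : Fin 6 → ℝ} (ha : a 0 ≠ 0) (γ : Fin 6) :
    ∑ s, ΨWInv a γ s * h1WEL b a s = ![0, b 3, b 4, -b 5, b 1, 0] γ := by
  fin_cases γ <;> simp [ΨWInv, h1WEL, Fin.sum_univ_six] <;> field_simp <;> ring

theorem differentiable_h1WEL {b a : ℝ → Fin 6 → ℝ} (hb : ∀ i, Differentiable ℝ (fun y => b y i))
    (ha : ∀ i, Differentiable ℝ (fun y => a y i)) (s : Fin 6) :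
    Differentiable ℝ (fun y => h1WEL (b y) (a y) s) := by
  fin_cases s <;> simp [h1WEL] <;> fun_prop

theorem sum_deriv_ΨW_inv_mul_ELd {b : ℝ → Fin 6 → ℝ} (hb : ContDiff ℝ (⊤ : ℕ∞) b)
    (hb1 : ∀ x, deriv b x 0 ≠ 0) (γ : Fin 6) (x : ℝ) :
    ∑ s, deriv (fun y => (ΨW (deriv b y))⁻¹ γ s * ELd h1W b s y) x
      = ![0, deriv b x 3, deriv b x 4, -deriv b x 5, deriv b x 1, 0] γ := by
  have hd (i : Fin 6) : Differentiable ℝ (fun y => b y i) :=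
    fun y => (hasDerivAt_coord hb i y).differentiableAt
  have hd' := differentiable_deriv_coord hb
  have hΨ (s : Fin 6) : Differentiable ℝ (fun y => ΨWInv (deriv b y) γ s) :=
    differentiable_ΨWInv hd' hb1 γ s
  have hE (s : Fin 6) : Differentiable ℝ (fun y => h1WEL (b y) (deriv b y) s) :=
    differentiable_h1WEL hd hd' s
  simp only [fun y => inv_ΨW (hb1 y), ELd_h1W hb]
  have hsum := deriv_fun_sum (u := Finset.univ) (x := x)
    (A := fun s y => ΨWInv (deriv b y) γ s * h1WEL (b y) (deriv b y) s)
    fun s _ => (hΨ s x).fun_mul (hE s x)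
  rw [← hsum]
  simp only [sum_ΨWInv_mul_h1WEL (hb1 _)]
  have p (i : Fin 6) : deriv (fun y => b y i) x = deriv b x i := (hasDerivAt_coord hb i x).deriv
  fin_cases γ <;> simp [p]

/-- The first six-component WDVV hydrodynamic type system, in potential form
b_y^i = v^i(b_x), is Hamiltonian with density h̃₁ with respect to the factorised
third-order Hamiltonian operator determined by Ψ and Φ. -/
theorem wdvv_first_system_hamiltonian
    (b : ℝ → Fin 6 → ℝ) (hb : ContDiff ℝ (⊤ : ℕ∞) b)
    (hb1 : ∀ x, deriv b x 0 ≠ 0) :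
    ∀ (i : Fin 6) (x : ℝ),
      -(∑ β, ∑ γ, ∑ s, ΦW⁻¹ β γ * (ΨW (deriv b x))⁻¹ β i *
          deriv (fun y => (ΨW (deriv b y))⁻¹ γ s * ELd h1W b s y) x)
        = vW (deriv b x) i := by
  intro i x
  have ha := hb1 x
  simp_rw [mul_assoc, ← Finset.mul_sum, sum_deriv_ΨW_inv_mul_ELd hb hb1, inv_ΨW ha, inv_ΦW]
  fin_cases i <;> simp [ΨWInv, vW, Fin.sum_univ_six] <;> field_simp <;> ring
end

section
/- Let s¹ = b¹, s² = b², s³ = b³, s⁴ = b⁴b_x¹, s⁵ = b⁵b_x¹ + b³b_x², s⁶ = b⁵b_x² + b³b_x⁴ + b⁶, viewed as densities s^α(b, b_x). Then for every α ∈ {1, …, 6}, every smooth curve b: ℝ → ℝ⁶ with b'¹(x) ≠ 0 for all x, and all i ∈ {1, …, 6} and all x, Σ_{β,γ,s} φ^{βγ} ψ^i_β(b'(x)) · (d/dx)[ψ^s_γ(b'(x)) E_s(s^α)(x)] = 0. That is, the functionals S^α = ∫ s^α dx are (nonlocal) Casimirs of the factorised third-order Hamiltonian operator determined by Ψ and Φ.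 -/
open scoped BigOperators

/-- The six nonlocal Casimir densities s¹,…,s⁶ of the WDVV third-order
Hamiltonian operator, as densities s^α(b, b_x). -/
noncomputable def sW : Fin 6 → (Fin 6 → ℝ) → (Fin 6 → ℝ) → ℝ :=
  ![fun b _ => b 0,
    fun b _ => b 1,
    fun b _ => b 2,
    fun b bx => b 3 * bx 0,
    fun b bx => b 4 * bx 0 + b 2 * bx 1,
    fun b bx => b 4 * bx 1 + b 2 * bx 3 + b 5]

/-- The determinant of a matrix with differentiable entries is differentiable. -/
lemma differentiable_det {n : Type*} [Fintype n] [DecidableEq n] {M : ℝ → Matrix n n ℝ}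
    (hM : ∀ i j, Differentiable ℝ fun y => M y i j) : Differentiable ℝ fun y => (M y).det := by
  simp only [Matrix.det_apply]
  fun_prop

/-- The inverse of an invertible matrix with differentiable entries has differentiable entries. -/
lemma differentiable_matrix_inv {n : Type*} [Fintype n] [DecidableEq n] {M : ℝ → Matrix n n ℝ}
    (hM : ∀ i j, Differentiable ℝ fun y => M y i j) (h0 : ∀ y, (M y).det ≠ 0) (i j : n) :
    Differentiable ℝ fun y => (M y)⁻¹ i j := by
  simp only [Matrix.inv_def, Ring.inverse_eq_inv', Matrix.smul_apply, smul_eq_mul,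
    Matrix.adjugate_apply]
  refine ((differentiable_det hM).inv h0).mul (differentiable_det fun k l => ?_)
  by_cases hk : k = j
  · subst hk
    simp
  · simpa [Matrix.updateRow_ne hk] using hM k l

lemma det_ΨW_ne_zero {a : Fin 6 → ℝ} (ha : a 0 ≠ 0) : (ΨW a).det ≠ 0 := by
  intro h
  obtain ⟨v, hv, h⟩ := Matrix.exists_mulVec_eq_zero_iff.mpr h
  apply hv
  have h' := fun i => congrFun h i
  simp only [ΨW, Fin.forall_fin_succ, Matrix.mulVec, dotProduct, Fin.sum_univ_succ] at h'
  simp at h'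
  obtain ⟨h0, h1, h2, h3, h4, h5⟩ := h'
  simp only [h5, ha, mul_zero, neg_zero, add_zero, neg_eq_zero, mul_eq_zero, false_or] at h3 h4
  simp only [h3, h4, h5, mul_zero, neg_zero, add_zero, zero_add] at h0 h1 h2
  ext i
  fin_cases i <;> simp_all

lemma fderiv_const_add_dotProduct_single {n : Type*} [Fintype n] [DecidableEq n] (c : ℝ)
    (q z : n → ℝ) (s : n) :
    fderiv ℝ (fun u => c + q ⬝ᵥ u) z (Pi.single s 1) = q s := by
  have h : HasFDerivAt (fun u => c + q ⬝ᵥ u)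
      (∑ i, q i • ContinuousLinearMap.proj (R := ℝ) (φ := fun _ : n => ℝ) i) z := by
    simp only [dotProduct]
    exact (HasFDerivAt.fun_sum fun i _ => (hasFDerivAt_apply i z).const_mul (q i)).const_add c
  simp [h.fderiv, Pi.single_apply]

/-- The Euler–Lagrange derivative of a density that is linear in `b` plus bilinear
in `(b, b_x)`. -/
lemma ELd_bilinear (p : Fin 6 → ℝ) (A : Matrix (Fin 6) (Fin 6) ℝ) {b : ℝ → Fin 6 → ℝ}
    (hb : Differentiable ℝ b) (s : Fin 6) (x : ℝ) :
    ELd (fun u v => p ⬝ᵥ u + u ⬝ᵥ A.mulVec v) b s x =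
      p s + A.mulVec (deriv b x) s - A.vecMul (deriv b x) s := by
  have h1 : (fun u => p ⬝ᵥ u + u ⬝ᵥ A.mulVec (deriv b x)) =
      fun u => 0 + (p + A.mulVec (deriv b x)) ⬝ᵥ u := by
    funext u
    rw [add_dotProduct, dotProduct_comm u, zero_add]
  have h2 : ∀ y, fderiv ℝ (fun v => p ⬝ᵥ b y + b y ⬝ᵥ A.mulVec v) (deriv b y) (Pi.single s 1) =
      A.vecMul (b y) s := by
    intro y
    simp only [Matrix.dotProduct_mulVec]
    exact fderiv_const_add_dotProduct_single _ _ _ _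
  have h3 : HasDerivAt (fun y => A.vecMul (b y) s) (A.vecMul (deriv b x) s) x := by
    simp only [Matrix.vecMul, dotProduct]
    exact HasDerivAt.fun_sum fun i _ =>
      (hasDerivAt_pi.mp (hb x).hasDerivAt i).mul_const (A i s)
  simp only [ELd, h1, h2, fderiv_const_add_dotProduct_single, h3.deriv, Pi.add_apply]

lemma ELd_sW {b : ℝ → Fin 6 → ℝ} (hb : Differentiable ℝ b) (α : Fin 6) :
    ∃ c : Fin 6 → ℝ, ∀ x s, ELd (sW α) b s x = (ΨW (deriv b x)).mulVec c s := by
  have key : ∃ (p : Fin 6 → ℝ) (A : Matrix (Fin 6) (Fin 6) ℝ) (c : Fin 6 → ℝ),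
      (∀ u v, sW α u v = p ⬝ᵥ u + u ⬝ᵥ A.mulVec v) ∧
      ∀ a s, p s + A.mulVec a s - A.vecMul a s = (ΨW a).mulVec c s := by
    fin_cases α
    · refine ⟨Pi.single 0 1, 0, Pi.single 0 1, ?_, ?_⟩
      · simp [sW]
      · intro a s
        fin_cases s <;> simp [ΨW]
    · refine ⟨Pi.single 1 1, 0, Pi.single 3 1, ?_, ?_⟩
      · simp [sW]
      · intro a s
        fin_cases s <;> simp [ΨW]
    · refine ⟨Pi.single 2 1, 0, Pi.single 5 1, ?_, ?_⟩
      · simp [sW]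
      · intro a s
        fin_cases s <;> simp [ΨW]
    · refine ⟨0, Matrix.single 3 0 1, -Pi.single 2 1, ?_, ?_⟩
      · intro u v
        simp [sW, Matrix.single_eq_single_vecMulVec_single,
          Matrix.vecMulVec_mulVec]
        ring
      · intro a s
        fin_cases s <;> simp [ΨW, Matrix.mulVec_neg,
          Matrix.single_eq_single_vecMulVec_single, Matrix.vecMulVec_mulVec, Matrix.vecMul_vecMulVec]
    · refine ⟨0, Matrix.single 4 0 1 + Matrix.single 2 1 1, -Pi.single 1 1, ?_, ?_⟩
      · intro u v
        simp [sW, Matrix.single_eq_single_vecMulVec_single, Matrix.add_mulVec,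
          Matrix.vecMulVec_mulVec]
        ring
      · intro a s
        fin_cases s <;> simp [ΨW, Matrix.mulVec_neg, Matrix.add_mulVec, Matrix.vecMul_add,
          Matrix.single_eq_single_vecMulVec_single, Matrix.vecMulVec_mulVec, Matrix.vecMul_vecMulVec]
    · refine ⟨Pi.single 5 1, Matrix.single 4 1 1 + Matrix.single 2 3 1, -Pi.single 4 1, ?_, ?_⟩
      · intro u v
        simp [sW, Matrix.single_eq_single_vecMulVec_single, Matrix.add_mulVec,
          Matrix.vecMulVec_mulVec]
        ring
      · intro a s
        fin_cases s <;> simp [ΨW, Matrix.mulVec_neg, Matrix.add_mulVec, Matrix.vecMul_add,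
          Matrix.single_eq_single_vecMulVec_single, Matrix.vecMulVec_mulVec, Matrix.vecMul_vecMulVec]
  obtain ⟨p, A, c, hs, hc⟩ := key
  refine ⟨c, fun x s => ?_⟩
  rw [show sW α = fun u v => p ⬝ᵥ u + u ⬝ᵥ A.mulVec v from funext₂ hs, ELd_bilinear p A hb, hc]

/-- The functionals S^α = ∫ s^α dx are (nonlocal) Casimirs of the factorised
third-order Hamiltonian operator determined by Ψ and Φ. -/
theorem wdvv_nonlocal_casimirs
    (b : ℝ → Fin 6 → ℝ) (hb : ContDiff ℝ (⊤ : ℕ∞) b)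
    (hb1 : ∀ x, deriv b x 0 ≠ 0) :
    ∀ (α i : Fin 6) (x : ℝ),
      ∑ β, ∑ γ, ∑ s, ΦW⁻¹ β γ * (ΨW (deriv b x))⁻¹ β i *
          deriv (fun y => (ΨW (deriv b y))⁻¹ γ s * ELd (sW α) b s y) x = 0 := by
  intro α i x
  have hbd : Differentiable ℝ b := hb.differentiable (by simp)
  have hb' : Differentiable ℝ (deriv b) :=
    (contDiff_infty_iff_deriv.mp hb).2.differentiable (by simp)
  have hbk : ∀ k, Differentiable ℝ fun y => deriv b y k := differentiable_pi.mp hb'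
  have hΨ : ∀ i j, Differentiable ℝ fun y => ΨW (deriv b y) i j := by
    intro i j
    fin_cases i <;> fin_cases j <;> simp [ΨW] <;> fun_prop
  have hdet := fun y => det_ΨW_ne_zero (hb1 y)
  have hinv := differentiable_matrix_inv hΨ hdet
  obtain ⟨c, hc⟩ := ELd_sW hbd α
  have hE : ∀ s, Differentiable ℝ fun y => ELd (sW α) b s y := by
    intro s
    simp only [hc, Matrix.mulVec, dotProduct]
    fun_prop
  refine Finset.sum_eq_zero fun β _ => Finset.sum_eq_zero fun γ _ => ?_
  rw [← Finset.mul_sum, ← deriv_fun_sum fun s _ => ((hinv γ s) x).fun_mul ((hE s) x)]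
  have hconst : (fun y => ∑ s, (ΨW (deriv b y))⁻¹ γ s * ELd (sW α) b s y) = fun _ => c γ := by
    funext y
    simp only [hc]
    change ((ΨW (deriv b y))⁻¹.mulVec ((ΨW (deriv b y)).mulVec c)) γ = c γ
    rw [Matrix.mulVec_mulVec, Matrix.nonsing_inv_mul _ (hdet y).isUnit, Matrix.one_mulVec]
  simp [hconst]
end
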